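/- Let α, β be Martin-Löf random left-c.e. reals. If D(α,β) < 1, then α − β is a Martin-Löf random left-c.e. real. -/

import Mathlib

open Filter MeasureTheory Set

/-- A real is left-c.e. if it is the limit of a computable increasing sequence of rationals. -/
def LeftCE (x : ℝ) : Prop :=
  ∃ f : ℕ → ℚ, Computable f ∧ Monotone f ∧
    Tendsto (fun n => (f n : ℝ)) atTop (nhds x)

/-- A real is right-c.e. if it is the limit of a computable decreasing sequence of rationals. -/
def RightCE (x : ℝ) : Prop :=
  ∃ f : ℕ → ℚ, Computable f ∧ Antitone f ∧
    Tendsto (fun n => (f n : ℝ)) atTop (nhds x)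

/-- The Σ⁰₁ class of reals given by level `i` of the computable enumeration `g` of
rational open intervals. -/
def testSet (g : ℕ → ℕ → ℚ × ℚ) (i : ℕ) : Set ℝ :=
  ⋃ n, Set.Ioo (((g i n).1 : ℝ)) (((g i n).2 : ℝ))

/-- A real is Martin-Löf random if for every Martin-Löf test, i.e. every uniformly c.e.
sequence of Σ⁰₁ classes `(U_i)` with `μ(U_i) ≤ 2⁻¹ ^ i`, the real avoids some level of
the test. -/
def MLRandom (x : ℝ) : Prop :=
  ∀ g : ℕ → ℕ → ℚ × ℚ, Computable₂ g →
    (∀ i, volume (testSet g i) ≤ 2⁻¹ ^ i) →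
    ∃ i, x ∉ testSet g i

/-- `DD α β` is the infimum of the positive rationals `q` such that `qα - β` is a
left-c.e. real. -/
noncomputable def DD (a b : ℝ) : ℝ :=
  sInf {x : ℝ | ∃ q : ℚ, 0 < q ∧ x = (q : ℝ) ∧ LeftCE ((q : ℝ) * a - b)}

/-- `DDstar α β` is the supremum of the positive rationals `q` such that `qα - β` is a
right-c.e. real. -/
noncomputable def DDstar (a b : ℝ) : ℝ :=
  sSup {x : ℝ | ∃ q : ℚ, 0 < q ∧ x = (q : ℝ) ∧ RightCE ((q : ℝ) * a - b)}


open Encodable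
def EE (q : ℚ) : ℕ := Nat.pair (encode q.num) q.den
def SS (m : ℕ) : Prop := 0 < m.unpair.2 ∧ ((Denumerable.ofNat ℤ m.unpair.1).natAbs).Coprime m.unpair.2
instance : DecidablePred SS := fun m => by unfold SS; infer_instance

theorem SS_EE (q : ℚ) : SS (EE q) := by
  simp only [SS, EE, Nat.unpair_pair, q.den_pos, true_and]
  have := q.reduced
  rwa [Denumerable.ofNat_encode]
theorem SS_iff (m : ℕ) : SS m ↔ m ∈ Set.range EE := by
  constructor
  · rintro ⟨h1, h2⟩
    refine ⟨⟨Denumerable.ofNat ℤ m.unpair.1, m.unpair.2, h1.ne', h2⟩, ?_⟩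
    simp only [EE]
    rw [Denumerable.encode_ofNat, Nat.pair_unpair]
  · rintro ⟨q, rfl⟩
    exact SS_EE q

theorem enc_eq (q : ℚ) : @encode ℚ Primcodable.toEncodable q = Nat.count SS (EE q) := by
  have : @encode ℚ Primcodable.toEncodable q = (List.range (EE q)).countP (fun m => @decide (m ∈ Set.range (@encode ℚ Rat.instEncodable)) (decidableRangeEncode ℚ m)) := by
    rfl
  rw [this, Nat.count]
  congr 1
  funext m
  rw [decide_eq_decide, SS_iff]
  rfl

theorem EE_inj {p q : ℚ} (h : EE p = EE q) : p = q := by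
  simp only [EE, Nat.pair_eq_pair, encode_inj] at h
  exact Rat.ext h.1 h.2

theorem comp_of_graph {α β} [Primcodable α] [Denumerable β] {f : α → β} {p : α → β → Bool}
    (hp : Computable₂ p) (h : ∀ a b, p a b = true ↔ f a = b) : Computable f := by
  have h1 : Partrec fun a => (Nat.rfind fun n => Part.some (p a (Denumerable.ofNat β n))) := by
    apply Partrec.rfind
    exact (hp.comp Computable.fst ((Computable.ofNat β).comp Computable.snd)).partrec.to₂
  have h2 : Partrec fun a => (Nat.rfind fun n => Part.some (p a (Denumerable.ofNat β n))).map
      (Denumerable.ofNat β) := h1.map ((Computable.ofNat β).comp Computable.snd).to₂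
  refine h2.of_eq_tot fun a => ?_
  obtain ⟨n, hn, -⟩ := Nat.rfind_min' (p := fun n => p a (Denumerable.ofNat β n)) (m := encode (f a))
    (by simp only [Denumerable.ofNat_encode]; exact (h _ _).2 rfl)
  rw [Part.mem_map_iff]
  refine ⟨n, hn, ?_⟩
  have := Nat.rfind_spec hn
  have h3 : true = p a (Denumerable.ofNat β n) := Part.mem_some_iff.1 this
  exact (h _ _).1 h3.symm |>.symm

def zp (c : ℕ) : ℕ := if c % 2 = 0 then c / 2 else 0
def zn (c : ℕ) : ℕ := if c % 2 = 0 then 0 else c / 2 + 1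
theorem z_eq (z : ℤ) : z = (zp (encode z) : ℤ) - zn (encode z) ∧ z.natAbs = zp (encode z) + zn (encode z) := by
  cases z with
  | ofNat n =>
    have : encode (Int.ofNat n) = 2 * n := rfl
    rw [this]; simp [zp, zn]
  | negSucc n =>
    have : encode (Int.negSucc n) = 2 * n + 1 := rfl
    rw [this]; simp [zp, zn, Nat.add_mod]
    omega
theorem prim_mod2 : PrimrecPred fun c : ℕ => c % 2 = 0 :=
  Primrec.eq.comp (Primrec.nat_mod.comp Primrec.id (Primrec.const 2)) (Primrec.const 0)
theorem prim_zp : Primrec zp :=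
  Primrec.ite prim_mod2 (Primrec.nat_div.comp Primrec.id (Primrec.const 2)) (Primrec.const 0)
theorem prim_zn : Primrec zn :=
  Primrec.ite prim_mod2 (Primrec.const 0)
    (Primrec.succ.comp (Primrec.nat_div.comp Primrec.id (Primrec.const 2)))

theorem cop_iff (a b : ℕ) : (0 < b ∧ a.Coprime b) ↔ 0 < b ∧ ¬ ∃ x < b + 1, x ≠ 1 ∧ (a % x = 0 ∧ b % x = 0) := by
  refine and_congr_right fun hb => ?_
  constructor
  · rintro h ⟨x, _, h1, h2, h3⟩
    exact h1 (Nat.eq_one_of_dvd_coprimes h (Nat.dvd_of_mod_eq_zero h2) (Nat.dvd_of_mod_eq_zero h3))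
  · intro h
    by_contra hc
    exact h ⟨a.gcd b, Nat.lt_succ_of_le (Nat.gcd_le_right _ hb), hc,
      Nat.mod_eq_zero_of_dvd (Nat.gcd_dvd_left _ _), Nat.mod_eq_zero_of_dvd (Nat.gcd_dvd_right _ _)⟩

theorem prim_SS : PrimrecPred SS := by
  have hb : Primrec fun m : ℕ => m.unpair.2 := Primrec.snd.comp Primrec.unpair
  have ha : Primrec fun m : ℕ => zp m.unpair.1 + zn m.unpair.1 :=
    Primrec.nat_add.comp (prim_zp.comp (Primrec.fst.comp Primrec.unpair))
      (prim_zn.comp (Primrec.fst.comp Primrec.unpair))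
  have hR : PrimrecRel fun (x m : ℕ) => x ≠ 1 ∧ ((zp m.unpair.1 + zn m.unpair.1) % x = 0 ∧ m.unpair.2 % x = 0) := by
    refine PrimrecPred.and (PrimrecPred.not (Primrec.eq.comp Primrec.fst (Primrec.const 1))) (PrimrecPred.and ?_ ?_)
    · exact Primrec.eq.comp (Primrec.nat_mod.comp (ha.comp Primrec.snd) Primrec.fst) (Primrec.const 0)
    · exact Primrec.eq.comp (Primrec.nat_mod.comp (hb.comp Primrec.snd) Primrec.fst) (Primrec.const 0)
  have h2 := hR.exists_lt.comp (Primrec.succ.comp hb) Primrec.id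
  have h3 := (Primrec.nat_lt.comp (Primrec.const 0) hb).and h2.not
  refine h3.of_eq fun m => ?_
  rw [SS]
  rw [cop_iff]
  have := (z_eq (Denumerable.ofNat ℤ m.unpair.1)).2
  rw [Denumerable.encode_ofNat] at this
  rw [this]; rfl

theorem prim_count : Primrec (Nat.count SS) := by
  have : Primrec fun n : ℕ => (Nat.rec 0 (fun m c => c + if SS m then 1 else 0) n : ℕ) := by
    apply Primrec.nat_rec₁
    refine Primrec.nat_add.comp Primrec.snd ?_
    exact Primrec.ite (prim_SS.comp Primrec.fst) (Primrec.const 1) (Primrec.const 0)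
  refine this.of_eq fun n => ?_
  induction n with
  | zero => simp
  | succ n ih => rw [Nat.count_succ, ← ih]

theorem comp_EE : Computable EE := by
  refine comp_of_graph (p := fun q m => decide (SS m ∧ Nat.count SS m = @encode ℚ Primcodable.toEncodable q)) ?_ ?_
  · apply Primrec.to_comp
    apply PrimrecPred.decide
    refine (prim_SS.comp Primrec.snd).and (Primrec.eq.comp (prim_count.comp Primrec.snd) (Primrec.encode.comp Primrec.fst))
  · intro q m
    rw [decide_eq_true_iff, enc_eq]
    constructor
    · rintro ⟨h1, h2⟩
      exact (Nat.count_injective h1 (SS_EE q) h2).symm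
    · rintro rfl
      exact ⟨SS_EE q, rfl⟩

/-- numerators (positive and negative part) and denominators -/
def qp (q : ℚ) : ℕ := zp (encode q.num)
def qn (q : ℚ) : ℕ := zn (encode q.num)
theorem comp_qp : Computable qp :=
  (prim_zp.to_comp.comp (Computable.fst.comp (Computable.unpair.comp comp_EE))).of_eq fun q => by
    simp [EE, qp]
theorem comp_qn : Computable qn :=
  (prim_zn.to_comp.comp (Computable.fst.comp (Computable.unpair.comp comp_EE))).of_eq fun q => by
    simp [EE, qn]
theorem comp_den : Computable Rat.den :=
  (Computable.snd.comp (Computable.unpair.comp comp_EE)).of_eq fun q => by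
    simp [EE]
theorem q_eq (q : ℚ) : q = ((qp q : ℚ) - qn q) / q.den := by
  have h := (z_eq q.num).1
  conv_lhs => rw [← Rat.num_div_den q, h]
  simp [qp, qn]

section ops
variable {α : Type*} [Primcodable α] {f g : α → ℚ}
theorem nadd {f g : α → ℕ} (hf : Computable f) (hg : Computable g) : Computable fun a => f a + g a :=
  Primrec.nat_add.to_comp.comp hf hg
theorem nmul {f g : α → ℕ} (hf : Computable f) (hg : Computable g) : Computable fun a => f a * g a :=
  Primrec.nat_mul.to_comp.comp hf hg
theorem nle {f g : α → ℕ} (hf : Computable f) (hg : Computable g) : Computable fun a => decide (f a ≤ g a) :=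
  Primrec.nat_le.decide.to_comp.comp hf hg
theorem neq {f g : α → ℕ} (hf : Computable f) (hg : Computable g) : Computable fun a => decide (f a = g a) :=
  (Primrec.eq (α := ℕ)).decide.to_comp.comp hf hg

theorem q_le_iff (q r : ℚ) : q ≤ r ↔ qp q * r.den + qn r * q.den ≤ qp r * q.den + qn q * r.den := by
  have h1 : (0:ℚ) < q.den := by exact_mod_cast q.den_pos
  have h2 : (0:ℚ) < r.den := by exact_mod_cast r.den_pos
  conv_lhs => rw [q_eq q, q_eq r, div_le_div_iff₀ h1 h2]
  rw [← Nat.cast_le (α := ℚ)]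
  push_cast
  constructor <;> intro h <;> linarith
theorem q_add_iff (q r t : ℚ) : q + r = t ↔ 
   (qp q * r.den + qp r * q.den) * t.den + qn t * (q.den * r.den) = 
   (qn q * r.den + qn r * q.den) * t.den + qp t * (q.den * r.den) := by
  have h1 : (q.den : ℚ) ≠ 0 := by exact_mod_cast q.den_nz
  have h2 : (r.den : ℚ) ≠ 0 := by exact_mod_cast r.den_nz
  have h3 : (t.den : ℚ) ≠ 0 := by exact_mod_cast t.den_nz
  conv_lhs => rw [q_eq q, q_eq r, q_eq t, div_add_div _ _ h1 h2, div_eq_div_iff (mul_ne_zero h1 h2) h3]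
  rw [← Nat.cast_inj (R := ℚ)]
  push_cast
  constructor <;> intro h <;> linarith
theorem q_mul_iff (q r t : ℚ) : q * r = t ↔ 
   (qp q * qp r + qn q * qn r) * t.den + qn t * (q.den * r.den) = 
   (qp q * qn r + qn q * qp r) * t.den + qp t * (q.den * r.den) := by
  have h1 : (q.den : ℚ) ≠ 0 := by exact_mod_cast q.den_nz
  have h2 : (r.den : ℚ) ≠ 0 := by exact_mod_cast r.den_nz
  have h3 : (t.den : ℚ) ≠ 0 := by exact_mod_cast t.den_nz
  conv_lhs => rw [q_eq q, q_eq r, q_eq t, div_mul_div_comm, div_eq_div_iff (mul_ne_zero h1 h2) h3]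
  rw [← Nat.cast_inj (R := ℚ)]
  push_cast
  constructor <;> intro h <;> linarith

theorem qle (hf : Computable f) (hg : Computable g) : Computable fun a => decide (f a ≤ g a) := by
  refine (nle (nadd (nmul (comp_qp.comp hf) (comp_den.comp hg)) (nmul (comp_qn.comp hg) (comp_den.comp hf)))
    (nadd (nmul (comp_qp.comp hg) (comp_den.comp hf)) (nmul (comp_qn.comp hf) (comp_den.comp hg)))).of_eq fun a => ?_
  rw [decide_eq_decide, q_le_iff]

theorem qadd (hf : Computable f) (hg : Computable g) : Computable fun a => f a + g a := by
  have F := hf.comp (Computable.fst (α := α) (β := ℚ))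
  have G := hg.comp (Computable.fst (α := α) (β := ℚ))
  have T := (Computable.snd (α := α) (β := ℚ))
  refine comp_of_graph (neq
    (nadd (nmul (nadd (nmul (comp_qp.comp F) (comp_den.comp G)) (nmul (comp_qp.comp G) (comp_den.comp F))) (comp_den.comp T)) (nmul (comp_qn.comp T) (nmul (comp_den.comp F) (comp_den.comp G))))
    (nadd (nmul (nadd (nmul (comp_qn.comp F) (comp_den.comp G)) (nmul (comp_qn.comp G) (comp_den.comp F))) (comp_den.comp T)) (nmul (comp_qp.comp T) (nmul (comp_den.comp F) (comp_den.comp G))))).to₂ ?_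
  intro a b
  rw [decide_eq_true_iff, q_add_iff]

theorem qmul (hf : Computable f) (hg : Computable g) : Computable fun a => f a * g a := by
  have F := hf.comp (Computable.fst (α := α) (β := ℚ))
  have G := hg.comp (Computable.fst (α := α) (β := ℚ))
  have T := (Computable.snd (α := α) (β := ℚ))
  refine comp_of_graph (neq
    (nadd (nmul (nadd (nmul (comp_qp.comp F) (comp_qp.comp G)) (nmul (comp_qn.comp F) (comp_qn.comp G))) (comp_den.comp T)) (nmul (comp_qn.comp T) (nmul (comp_den.comp F) (comp_den.comp G))))
    (nadd (nmul (nadd (nmul (comp_qp.comp F) (comp_qn.comp G)) (nmul (comp_qn.comp F) (comp_qp.comp G))) (comp_den.comp T)) (nmul (comp_qp.comp T) (nmul (comp_den.comp F) (comp_den.comp G))))).to₂ ?_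
  intro a b
  rw [decide_eq_true_iff, q_mul_iff]

theorem qsub (hf : Computable f) (hg : Computable g) : Computable fun a => f a - g a :=
  (qadd hf (qmul (Computable.const (-1)) hg)).of_eq fun a => by ring

theorem qite {f g h k : α → ℚ} (hf : Computable f) (hg : Computable g) (hh : Computable h) (hk : Computable k) :
    Computable fun a => if f a ≤ g a then h a else k a :=
  (Computable.cond (qle hf hg) hh hk).of_eq fun a => by
    by_cases H : f a ≤ g a <;> simp [H]
theorem qmax (hf : Computable f) (hg : Computable g) : Computable fun a => max (f a) (g a) :=
  (qite hf hg hg hf).of_eq fun _ => (max_def _ _).symm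

theorem qpow (c : ℚ) {f : α → ℕ} (hf : Computable f) : Computable fun a => c ^ f a := by
  have hs : Computable fun x : α × (ℕ × ℚ) => x.2.2 * c :=
    qmul (Computable.snd.comp Computable.snd) (Computable.const c)
  have : Computable fun a => (Nat.rec 1 (fun _ r => r * c) (f a) : ℚ) :=
    Computable.nat_rec hf (Computable.const 1) hs.to₂
  refine this.of_eq fun a => ?_
  induction f a with
  | zero => simp
  | succ n ih => rw [pow_succ, ← ih]
end ops

theorem LeftCE.add {x y : ℝ} (hx : LeftCE x) (hy : LeftCE y) : LeftCE (x + y) := by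
  obtain ⟨f, hf, mf, tf⟩ := hx
  obtain ⟨g, hg, mg, tg⟩ := hy
  refine ⟨fun n => f n + g n, qadd hf hg, mf.add mg, ?_⟩
  simpa using tf.add tg

theorem LeftCE.smul {x : ℝ} (hx : LeftCE x) (r : ℚ) (hr : 0 ≤ r) : LeftCE (r * x) := by
  obtain ⟨f, hf, mf, tf⟩ := hx
  refine ⟨fun n => r * f n, qmul (Computable.const r) hf, mf.const_mul hr, ?_⟩
  simpa using tf.const_mul (r : ℝ)

theorem LeftCE.strict {x : ℝ} (hx : LeftCE x) : ∃ f : ℕ → ℚ, Computable f ∧ StrictMono f ∧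
    Tendsto (fun n => (f n : ℝ)) atTop (nhds x) := by
  obtain ⟨f, hf, mf, tf⟩ := hx
  refine ⟨fun n => f n - (1/2) ^ n, qsub hf (qpow _ Computable.id), ?_, ?_⟩
  · apply strictMono_nat_of_lt_succ
    intro n
    have h1 := mf (Nat.le_succ n)
    have h2 : (0:ℚ) < (1/2)^n := by positivity
    simp only [Nat.succ_eq_add_one] at h1
    rw [pow_succ]; linarith
  · have : Tendsto (fun n : ℕ => ((1:ℝ)/2) ^ n) atTop (nhds 0) :=
      tendsto_pow_atTop_nhds_zero_of_lt_one (by norm_num) (by norm_num)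
    simpa using tf.sub this

theorem lt_of_strict {x : ℝ} {f : ℕ → ℚ} (hf : StrictMono f)
    (h : Tendsto (fun n => (f n : ℝ)) atTop (nhds x)) (n : ℕ) : (f n : ℝ) < x := by
  have hm : Monotone fun n => (f n : ℝ) := fun a b hab => by
    simp only; exact_mod_cast hf.monotone hab
  have h1 : (f n : ℝ) < f (n+1) := by exact_mod_cast hf (Nat.lt_succ_self n)
  exact h1.trans_le (hm.ge_of_tendsto h (n+1))

theorem pow_conv (i : ℕ) : ENNReal.ofReal ((1/2:ℝ)^i) = 2⁻¹ ^ i := by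
  rw [ENNReal.ofReal_pow (by norm_num)]
  congr 1
  rw [one_div, ENNReal.ofReal_inv_of_pos (by norm_num)]
  simp

/-- water level -/
def lev (A B : ℕ → ℚ) (c : ℚ) (n : ℕ) : ℚ :=
  Nat.rec (A 0) (fun s e => max e (A s) + c * (B (s+1) - B s)) n

theorem lev_succ (A B : ℕ → ℚ) (c : ℚ) (n : ℕ) :
    lev A B c (n+1) = max (lev A B c n) (A n) + c * (B (n+1) - B n) := rfl

theorem comp_lev {A B : ℕ → ℚ} (hA : Computable A) (hB : Computable B) {α : Type*} [Primcodable α]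
    {c : α → ℚ} {n : α → ℕ} (hc : Computable c) (hn : Computable n) :
    Computable fun a => lev A B (c a) (n a) := by
  have hs : Computable fun x : α × (ℕ × ℚ) =>
      max x.2.2 (A x.2.1) + c x.1 * (B (x.2.1 + 1) - B x.2.1) := by
    have h1 : Computable fun x : α × (ℕ × ℚ) => x.2.1 := Computable.fst.comp Computable.snd
    have h2 : Computable fun x : α × (ℕ × ℚ) => x.2.2 := Computable.snd.comp Computable.snd
    have h4 : Computable fun x : α × (ℕ × ℚ) => x.2.1 + 1 := nadd h1 (Computable.const 1)
    have h5 : Computable fun x : α × (ℕ × ℚ) => A x.2.1 := hA.comp h1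
    have h6 : Computable fun x : α × (ℕ × ℚ) => B x.2.1 := hB.comp h1
    have h7 : Computable fun x : α × (ℕ × ℚ) => B (x.2.1 + 1) := hB.comp h4
    have h8 : Computable fun x : α × (ℕ × ℚ) => c x.1 := hc.comp Computable.fst
    have h9 := qmax h2 h5
    have h10 := qmul h8 (qsub h7 h6)
    exact qadd h9 h10
  have h0 : Computable fun _ : α => A 0 := Computable.const (A 0)
  have h3 := Computable.nat_rec hn h0 hs.to₂
  refine h3.of_eq fun a => ?_
  induction n a with
  | zero => rfl
  | succ m ih => rw [lev_succ, ← ih]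

theorem KS {a b : ℝ} (ha : LeftCE a) (har : MLRandom a) (hb : LeftCE b) :
    ∃ c : ℚ, 0 < c ∧ LeftCE (a - c * b) := by
  obtain ⟨A, cA, mA, tA⟩ := ha.strict
  obtain ⟨B, cB, mB, tB⟩ := hb
  have mB' : Monotone fun n => (B n : ℝ) := fun a b hab => by
    simp only; exact_mod_cast mB hab
  obtain ⟨k, hk⟩ := pow_unbounded_of_one_lt (2 * (b - B 0)) (one_lt_two)
  set c : ℕ → ℚ := fun i => (1/2) ^ (i + k) with hc
  have cpos : ∀ i, 0 < c i := fun i => by simp only [hc]; positivity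
  set g : ℕ → ℕ → ℚ × ℚ := fun i s =>
    (max (lev A B (c i) s) (A s) - c i * (B (s+1) - B s),
      max (lev A B (c i) s) (A s) + c i * (B (s+1) - B s)) with hg
  have cg : Computable₂ g := by
    have cc : Computable fun x : ℕ × ℕ => c x.1 :=
      qpow _ (nadd Computable.fst (Computable.const k))
    have cs := (Computable.snd (α := ℕ) (β := ℕ))
    have m := qmax (comp_lev cA cB cc cs) (cA.comp cs)
    have d := qmul cc (qsub (cB.comp (Computable.succ.comp cs)) (cB.comp cs))
    exact Computable.pair (qsub m d) (qadd m d)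
  obtain ⟨i, hi⟩ := har g cg (fun i => by
    rw [testSet]
    refine (measure_iUnion_le _).trans ?_
    simp only [Real.volume_Ioo]
    rw [ENNReal.tsum_eq_iSup_nat]
    refine iSup_le fun n => ?_
    rw [← ENNReal.ofReal_sum_of_nonneg, ← pow_conv]
    · apply ENNReal.ofReal_le_ofReal
      have : ∀ s, (((g i s).2 : ℝ) - ((g i s).1 : ℝ)) = 2 * c i * ((B (s+1) : ℝ) - B s) := by
        intro s; simp only [hg]; push_cast; ring
      simp only [this]
      rw [← Finset.mul_sum, Finset.sum_range_sub (fun s => (B s : ℝ))]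
      have h1 : (B n : ℝ) ≤ b := mB'.ge_of_tendsto tB n
      have h2 : ((c i : ℚ) : ℝ) * 2 ^ k = (1/2) ^ i := by
        simp only [hc]; push_cast; rw [pow_add, mul_assoc, ← mul_pow]; norm_num
      have h3 : (0:ℝ) < c i := by exact_mod_cast cpos i
      nlinarith
    · intro s _
      have h4 : (B s : ℝ) ≤ B (s+1) := mB' (Nat.le_succ s)
      have h3 : (0:ℝ) < c i := by exact_mod_cast cpos i
      simp only [hg]; push_cast
      nlinarith)
  refine ⟨c i, cpos i, ?_⟩
  set e := lev A B (c i) with he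
  have hd : ∀ s, 0 ≤ c i * (B (s+1) - B s) := fun s =>
    mul_nonneg (cpos i).le (sub_nonneg.2 (mB (Nat.le_succ s)))
  have ele : ∀ s, (e s : ℝ) ≤ a := by
    intro s
    induction s with
    | zero => exact (lt_of_strict mA tA 0).le
    | succ s ih =>
      by_contra hlt
      push Not at hlt
      apply hi
      rw [testSet, mem_iUnion]
      have hm : ((max (e s) (A s) : ℚ) : ℝ) ≤ a := by
        push_cast; exact max_le ih (lt_of_strict mA tA s).le
      have h1 : (e (s+1) : ℝ) = ((max (e s) (A s) : ℚ) : ℝ) + ((c i * (B (s+1) - B s) : ℚ) : ℝ) := by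
        rw [← Rat.cast_add]; rfl
      refine ⟨s, ?_, ?_⟩
      · simp only [hg]
        rw [Rat.cast_sub]
        linarith
      · simp only [hg]
        rw [Rat.cast_add]
        linarith
  have te : Tendsto (fun n => (e n : ℝ)) atTop (nhds a) := by
    rw [← tendsto_add_atTop_iff_nat 1]
    refine tendsto_of_tendsto_of_tendsto_of_le_of_le tA tendsto_const_nhds ?_ (fun n => ele _)
    intro n
    have : A n ≤ e (n+1) := by
      rw [he, lev_succ]
      linarith [le_max_right (lev A B (c i) n) (A n), hd n]
    simp only; exact_mod_cast this
  refine ⟨fun n => e n - c i * B n, ?_, ?_, ?_⟩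
  · exact qsub (comp_lev cA cB (Computable.const (c i)) Computable.id) (qmul (Computable.const _) cB)
  · apply monotone_nat_of_le_succ
    intro n
    rw [he, lev_succ]
    linarith [le_max_left (lev A B (c i) n) (A n)]
  · simpa using te.sub (tB.const_mul ((c i : ℚ) : ℝ))

theorem vol_le {U V : Set ℝ} {φ : ℝ → ℝ} {K : NNReal} (hm : MapsTo φ U V)
    (h : ∀ p ∈ U, ∀ p' ∈ U, dist p p' ≤ K * dist (φ p) (φ p')) : volume U ≤ K * volume V := by
  have inj : InjOn φ U := fun p hp p' hp' e => by
    have := h p hp p' hp'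
    rw [e, dist_self, mul_zero] at this
    exact dist_le_zero.1 this
  have L : LipschitzOnWith K (Function.invFunOn φ U) (φ '' U) := by
    apply LipschitzOnWith.of_dist_le_mul
    rintro _ ⟨p, hp, rfl⟩ _ ⟨p', hp', rfl⟩
    rw [inj.leftInvOn_invFunOn hp, inj.leftInvOn_invFunOn hp']
    exact h p hp p' hp'
  have := L.hausdorffMeasure_image_le (d := 1) zero_le_one
  rw [hausdorffMeasure_real, inj.invFunOn_image Subset.rfl, ENNReal.rpow_one] at this
  refine this.trans ?_
  gcongr
  exact hm.image_subset

theorem random_add {a d : ℝ} (ha : LeftCE a) (har : MLRandom a) (hd : LeftCE d) (r : ℚ) (hr : 0 < r) :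
    MLRandom (r * a + d) := by
  obtain ⟨A, cA, mA, tA⟩ := ha.strict
  obtain ⟨D, cD, mD, tD⟩ := hd
  intro g cg hgv
  have hr' : (0:ℝ) < r := by exact_mod_cast hr
  obtain ⟨k, hk⟩ := pow_unbounded_of_one_lt ((r:ℝ)⁻¹) (one_lt_two)
  set G : ℕ → ℕ → ℚ × ℚ := fun i n =>
    (A n.unpair.1, if (g (i+k) n.unpair.2).1 ≤ r * A n.unpair.1 + D n.unpair.1 then
      A n.unpair.1 + r⁻¹ * ((g (i+k) n.unpair.2).2 - (r * A n.unpair.1 + D n.unpair.1)) else A n.unpair.1) with hG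
  have cG : Computable₂ G := by
    have c1 : Computable fun x : ℕ × ℕ => x.2.unpair.1 :=
      Computable.fst.comp (Computable.unpair.comp Computable.snd)
    have c2 : Computable fun x : ℕ × ℕ => x.2.unpair.2 :=
      Computable.snd.comp (Computable.unpair.comp Computable.snd)
    have c3 : Computable fun x : ℕ × ℕ => g (x.1 + k) x.2.unpair.2 :=
      cg.comp (nadd Computable.fst (Computable.const k)) c2
    have c4 := qadd (qmul (Computable.const r) (cA.comp c1)) (cD.comp c1)
    exact Computable.pair (cA.comp c1) (qite (Computable.fst.comp c3) c4
      (qadd (cA.comp c1) (qmul (Computable.const r⁻¹) (qsub (Computable.snd.comp c3) c4))) (cA.comp c1))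
  -- membership
  have mem : ∀ i p, p ∈ testSet G i ↔ ∃ s j, ((g (i+k) j).1 : ℝ) ≤ r * A s + D s ∧ (A s : ℝ) < p ∧
      r * p + D s < (g (i+k) j).2 := by
    intro i p
    have key : ∀ s j, ((g (i+k) j).1 ≤ r * A s + D s) →
        (p < ((A s + r⁻¹ * ((g (i+k) j).2 - (r * A s + D s)) : ℚ) : ℝ) ↔ r * p + D s < (g (i+k) j).2) := by
      intro s j _
      have : ((A s + r⁻¹ * ((g (i+k) j).2 - (r * A s + D s)) : ℚ) : ℝ) = ((g (i+k) j).2 - D s) / r := by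
        push_cast; field_simp; ring
      rw [this, lt_div_iff₀ hr']
      constructor <;> intro h <;> linarith
    rw [testSet, mem_iUnion]
    constructor
    · rintro ⟨n, h1, h2⟩
      simp only [hG] at h1 h2
      split_ifs at h2 with hc
      · exact ⟨_, _, by exact_mod_cast hc, h1, (key _ _ hc).1 h2⟩
      · exact absurd h2 (not_lt.2 h1.le)
    · rintro ⟨s, j, h0, h1, h2⟩
      have h0' : (g (i+k) j).1 ≤ r * A s + D s := by exact_mod_cast h0
      refine ⟨Nat.pair s j, ?_, ?_⟩
      · simpa only [hG, Nat.unpair_pair] using h1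
      · simp only [hG, Nat.unpair_pair]
        rw [if_pos h0']
        exact (key _ _ h0').2 h2
  obtain ⟨i, hi⟩ := har G cG (fun i => by
    classical
    let P : ℝ → ℕ → Prop := fun p s => ∃ j, ((g (i+k) j).1 : ℝ) ≤ r * A s + D s ∧ (A s : ℝ) < p ∧
      r * p + D s < (g (i+k) j).2
    have hP : ∀ p ∈ testSet G i, ∃ s, P p s := fun p hp => (mem i p).1 hp
    let σ : ℝ → ℕ := fun p => if h : ∃ s, P p s then Nat.find h else 0
    have hσ : ∀ p ∈ testSet G i, P p (σ p) ∧ ∀ s < σ p, ¬ P p s := by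
      intro p hp
      have h := hP p hp
      simp only [σ, dif_pos h]
      exact ⟨Nat.find_spec h, fun s hs => Nat.find_min h hs⟩
    have mono : ∀ p ∈ testSet G i, ∀ p' ∈ testSet G i, p < p' → σ p ≤ σ p' := by
      intro p hp p' hp' hlt
      by_contra hc
      push Not at hc
      apply (hσ p hp).2 _ hc
      obtain ⟨j, h0, h1, h2⟩ := (hσ p' hp').1
      obtain ⟨_, -, h3, -⟩ := (hσ p hp).1
      have h4 : (A (σ p') : ℝ) < A (σ p) := by exact_mod_cast mA hc
      exact ⟨j, h0, h4.trans h3, by nlinarith⟩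
    have key : volume (testSet G i) ≤ ((r:ℝ)⁻¹).toNNReal * volume (testSet g (i+k)) := by
      refine vol_le (φ := fun p => r * p + D (σ p)) ?_ ?_
      · intro p hp
        obtain ⟨j, h0, h1, h2⟩ := (hσ p hp).1
        rw [testSet, mem_iUnion]
        exact ⟨j, by simp only; nlinarith, h2⟩
      · have main : ∀ p ∈ testSet G i, ∀ p' ∈ testSet G i, p < p' →
          dist p p' ≤ ((r:ℝ)⁻¹).toNNReal * dist (r * p + D (σ p)) (r * p' + D (σ p')) := by
          intro p hp p' hp' hlt
          have h5 : (D (σ p) : ℝ) ≤ D (σ p') := by exact_mod_cast mD (mono p hp p' hp' hlt)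
          rw [Real.coe_toNNReal _ (inv_pos.2 hr').le, dist_comm, dist_comm (r * p + D (σ p) : ℝ),
            Real.dist_eq, Real.dist_eq, abs_of_pos (sub_pos.2 hlt),
            inv_mul_eq_div, le_div_iff₀ hr']
          refine le_trans ?_ (le_abs_self _)
          linarith
        intro p hp p' hp'
        rcases lt_trichotomy p p' with h | h | h
        · exact main p hp p' hp' h
        · subst h; simp
        · have := main p' hp' p hp h
          rwa [dist_comm, dist_comm (r * p' + D (σ p') : ℝ)] at this
    refine key.trans ?_
    refine (mul_le_mul_right (hgv (i+k)) _).trans ?_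
    rw [← pow_conv, ← pow_conv]
    change ENNReal.ofReal _ * _ ≤ _
    rw [← ENNReal.ofReal_mul (inv_pos.2 hr').le]
    apply ENNReal.ofReal_le_ofReal
    have h2 : (2:ℝ) ^ k * (1/2) ^ (i + k) = (1/2) ^ i := by
      rw [pow_add, mul_left_comm, ← mul_pow]; norm_num
    rw [← h2]
    gcongr)
  refine ⟨i + k, fun hin => hi ?_⟩
  rw [testSet, mem_iUnion] at hin
  obtain ⟨j, h1, h2⟩ := hin
  rw [mem]
  have t : Tendsto (fun s => (r * A s + D s : ℝ)) atTop (nhds (r * a + d)) := (tA.const_mul _).add tD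
  obtain ⟨s, hs⟩ := (t.eventually (lt_mem_nhds h1)).exists
  refine ⟨s, j, hs.le, lt_of_strict mA tA s, ?_⟩
  have mD' : Monotone fun n => (D n : ℝ) := fun a b hab => by
    simp only; exact_mod_cast mD hab
  have : (D s : ℝ) ≤ d := mD'.ge_of_tendsto tD s
  linarith

/-- Let `α, β` be Martin-Löf random left-c.e. reals. If `D(α,β) < 1`, then `α - β` is a
Martin-Löf random left-c.e. real. -/
theorem D_lt_one (a b : ℝ) (ha : LeftCE a) (har : MLRandom a)
    (hb : LeftCE b) (hbr : MLRandom b) (h : DD a b < 1) :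
    LeftCE (a - b) ∧ MLRandom (a - b) := by
  have hne : {x : ℝ | ∃ q : ℚ, 0 < q ∧ x = (q : ℝ) ∧ LeftCE ((q : ℝ) * a - b)}.Nonempty := by
    obtain ⟨c, hc, hl⟩ := KS ha har hb
    refine ⟨((c⁻¹ : ℚ) : ℝ), c⁻¹, inv_pos.2 hc, rfl, ?_⟩
    have := hl.smul c⁻¹ (inv_pos.2 hc).le
    have hc' : (c : ℝ) ≠ 0 := by exact_mod_cast hc.ne'
    convert this using 1
    push_cast
    field_simp
  obtain ⟨_, ⟨q, hq, rfl, hl⟩, hq1⟩ := exists_lt_of_csInf_lt hne h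
  have hq1' : q < 1 := by exact_mod_cast hq1
  have e : a - b = ((1 - q : ℚ) : ℝ) * a + (q * a - b) := by push_cast; ring
  rw [e]
  exact ⟨(ha.smul _ (sub_pos.2 hq1').le).add hl, random_add ha har hl _ (sub_pos.2 hq1')⟩
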